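/- Let A = {(diag(a, 1/a), 0) : a > 0} ⊆ G. For a closed subgroup H of G, the following are equivalent: (1) there exists a sequence (x_n) in G such that x_n A x_n⁻¹ converges to H in the Chabauty sense; (2) there exists x ∈ G such that H = x A x⁻¹, or H = x V_{(r₁,r₂,r₃)} x⁻¹ for some r₁, r₂, r₃ ∈ ℝ satisfying r₁ = 1, or r₃ = 1, or (r₁ = 0 and r₂ = 1). -/

import Mathlib

open Filter Topology

noncomputable section

/-- `SL(2,ℝ)`. -/
abbrev SL2 := Matrix.SpecialLinearGroup (Fin 2) ℝ

/-- The topology on `SL(2,ℝ)` induced from the space of `2×2` real matrices. -/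
instance : TopologicalSpace SL2 :=
  TopologicalSpace.induced ((↑) : SL2 → Matrix (Fin 2) (Fin 2) ℝ) inferInstance

/-- The underlying type of the group `G = SL(2,ℝ) ⋉ ℝ²`, with the product topology. -/
abbrev GG := SL2 × (Fin 2 → ℝ)

/-- Multiplication in `G`: `(g,v)(g',v') = (gg', v + g·v')`. -/
def gmul (x y : GG) : GG := (x.1 * y.1, x.2 + (x.1 : Matrix (Fin 2) (Fin 2) ℝ).mulVec y.2)

/-- The identity element of `G`. -/
def gone : GG := (1, 0)

/-- Inversion in `G`. -/
def ginv (x : GG) : GG := (x.1⁻¹, -((x.1⁻¹ : SL2) : Matrix (Fin 2) (Fin 2) ℝ).mulVec x.2)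

/-- The conjugate `x H x⁻¹` of a subset `H ⊆ G` by `x ∈ G`. -/
def conjSet (x : GG) (H : Set GG) : Set GG := (fun h => gmul (gmul x h) (ginv x)) '' H

/-- `H` is a closed subgroup of `G`. -/
def IsClosedSubgroup (H : Set GG) : Prop :=
  IsClosed H ∧ gone ∈ H ∧ (∀ a ∈ H, ∀ b ∈ H, gmul a b ∈ H) ∧ (∀ a ∈ H, ginv a ∈ H)

/-- Chabauty convergence of a sequence of subsets of a topological space:
(i) every point of the limit is a limit of a sequence of points of the `S n`;
(ii) every limit of a subsequence of points of the `S n` lies in the limit set. -/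
def ChabautyTendsto {X : Type*} [TopologicalSpace X] (S : ℕ → Set X) (T : Set X) : Prop :=
  (∀ h ∈ T, ∃ u : ℕ → X, (∀ n, u n ∈ S n) ∧ Tendsto u atTop (𝓝 h)) ∧
  (∀ k : ℕ → ℕ, StrictMono k → ∀ u : ℕ → X, (∀ n, u n ∈ S (k n)) →
    ∀ x : X, Tendsto u atTop (𝓝 x) → x ∈ T)

/-- The Levi subgroup `L = SL(2,ℝ) × {0}`. -/
def Lset : Set GG := {x | x.2 = 0}

/-- The subgroup `N⁺ ⋉ ℝ² = {((1,s;0,1), v) : s ∈ ℝ, v ∈ ℝ²}`. -/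
def NplusR2 : Set GG := {x | ∃ s : ℝ, (x.1 : Matrix (Fin 2) (Fin 2) ℝ) = !![1, s; 0, 1]}

/-- The maximal compact subgroup `K = SO(2,ℝ) × {0}`. -/
def Kset : Set GG :=
  {x | ∃ θ : ℝ, (x.1 : Matrix (Fin 2) (Fin 2) ℝ) =
      !![Real.cos θ, Real.sin θ; -Real.sin θ, Real.cos θ] ∧ x.2 = 0}

/-- `V_c = {(I,(t,ct)) : t ∈ ℝ}`. -/
def Vc (c : ℝ) : Set GG := {x | ∃ t : ℝ, x.1 = 1 ∧ x.2 = ![t, c * t]}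

/-- `V_∞ = {(I,(0,t)) : t ∈ ℝ}`. -/
def Vinf : Set GG := {x | ∃ t : ℝ, x.1 = 1 ∧ x.2 = ![0, t]}

/-- `Ñ⁺ = {(±(1,s;0,1), 0) : s ∈ ℝ}`. -/
def Ntilde : Set GG :=
  {x | (∃ s : ℝ, (x.1 : Matrix (Fin 2) (Fin 2) ℝ) = !![1, s; 0, 1] ∨
      (x.1 : Matrix (Fin 2) (Fin 2) ℝ) = -!![1, s; 0, 1]) ∧ x.2 = 0}

/-- The diagonal subgroup `A = {(diag(a,1/a), 0) : a > 0}`. -/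
def Aset : Set GG :=
  {x | ∃ a : ℝ, 0 < a ∧ (x.1 : Matrix (Fin 2) (Fin 2) ℝ) = !![a, 0; 0, a⁻¹] ∧ x.2 = 0}

/-- `V_{(a,b,c)} = {((1,at;0,1), (ct + abt²/2, bt)) : t ∈ ℝ}`. -/
def Vabc (a b c : ℝ) : Set GG :=
  {x | ∃ t : ℝ, (x.1 : Matrix (Fin 2) (Fin 2) ℝ) = !![1, a * t; 0, 1] ∧
      x.2 = ![c * t + a * b * t ^ 2 / 2, b * t]}

/-- The upper triangular Borel subgroup `B` of `SL(2,ℝ)`, inside `G`. -/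
def Bset : Set GG :=
  {x | ∃ a s : ℝ, a ≠ 0 ∧ (x.1 : Matrix (Fin 2) (Fin 2) ℝ) = !![a, s; 0, a⁻¹] ∧ x.2 = 0}

/-- `W = {((1,s;0,1), (t,0)) : s, t ∈ ℝ} = N⁺ ⋉ {(t,0)}`. -/
def Wset : Set GG :=
  {x | ∃ s t : ℝ, (x.1 : Matrix (Fin 2) (Fin 2) ℝ) = !![1, s; 0, 1] ∧ x.2 = ![t, 0]}

/-- The Borel subgroup `P = B ⋉ ℝ²` of `G`. -/
def Pset : Set GG :=
  {x | ∃ a s : ℝ, a ≠ 0 ∧ (x.1 : Matrix (Fin 2) (Fin 2) ℝ) = !![a, s; 0, a⁻¹]}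

/-- The translation subgroup `ℝ² = {(I,v) : v ∈ ℝ²}`. -/
def R2set : Set GG := {x | x.1 = 1}

/-- The unipotent subgroup `N⁺ = {((1,s;0,1), 0) : s ∈ ℝ}`. -/
def Nplus : Set GG := {x | ∃ s : ℝ, (x.1 : Matrix (Fin 2) (Fin 2) ℝ) = !![1, s; 0, 1] ∧ x.2 = 0}

/-- `V₀ = {(I,(t,0)) : t ∈ ℝ}`. -/
def V0 : Set GG := {x | ∃ t : ℝ, x.1 = 1 ∧ x.2 = ![t, 0]}

def upperUnipotent (s : ℝ) : SL2 :=
  ⟨!![1, s; 0, 1], by simp [Matrix.det_fin_two_of]⟩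

/-- Coordinates on the Lie algebra `sl(2,ℝ) ⋉ ℝ²`: the vector `X` stands for the pair consisting of
the matrix `!![X 0, X 1; X 2, -X 0]` and the translation part `![X 3, X 4]`. -/
abbrev LieCoord := Fin 5 → ℝ

/-- Minus the determinant of the linear part of `X`. -/
def negDet (X : LieCoord) : ℝ := X 0 ^ 2 + X 1 * X 2

/-- Half the trace of the linear part of the point of parameter `p` in `oneParam X`. -/
def halfTrace (X : LieCoord) (p : ℝ) : ℝ := √(1 + negDet X * p ^ 2)

/-- The linear part of the point of parameter `p` in `oneParam X`. -/
def curveLin (X : LieCoord) (p : ℝ) : Matrix (Fin 2) (Fin 2) ℝ :=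
  !![halfTrace X p + p * X 0, p * X 1; p * X 2, halfTrace X p - p * X 0]

/-- The translation part of the point of parameter `p` in `oneParam X`. -/
def curveTrans (X : LieCoord) (p : ℝ) : Fin 2 → ℝ :=
  ![p * X 3 + p ^ 2 / (1 + halfTrace X p) * (X 0 * X 3 + X 1 * X 4),
    p * X 4 + p ^ 2 / (1 + halfTrace X p) * (X 2 * X 3 - X 0 * X 4)]

/-- The one-parameter subgroup generated by `X`, when `0 ≤ negDet X`. With `ε = √(negDet X)`, the
parameter `p` corresponds to `exp (t X)` where `p = sinh (ε t) / ε` (`p = t` if `ε = 0`). -/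
def oneParam (X : LieCoord) : Set GG :=
  {x | ∃ p : ℝ, (x.1 : Matrix (Fin 2) (Fin 2) ℝ) = curveLin X p ∧ x.2 = curveTrans X p}

/-- The adjoint action of `G` on its Lie algebra. -/
def adjAct (y : GG) (X : LieCoord) : LieCoord :=
  let a := y.1 0 0
  let b := y.1 0 1
  let c := y.1 1 0
  let d := y.1 1 1
  let α := X 0 * (a * d + b * c) + b * d * X 2 - a * c * X 1
  let β := -2 * a * b * X 0 - b ^ 2 * X 2 + a ^ 2 * X 1
  let γ := 2 * c * d * X 0 + d ^ 2 * X 2 - c ^ 2 * X 1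
  ![α, β, γ, a * X 3 + b * X 4 - (α * y.2 0 + β * y.2 1),
    c * X 3 + d * X 4 - (γ * y.2 0 - α * y.2 1)]

lemma SL2.det_eq (g : SL2) : g 0 0 * g 1 1 - g 0 1 * g 1 0 = 1 := by
  rw [← Matrix.det_fin_two, g.det_coe]

lemma halfTrace_sq {X : LieCoord} (hX : 0 ≤ negDet X) (p : ℝ) :
    halfTrace X p ^ 2 = 1 + negDet X * p ^ 2 :=
  Real.sq_sqrt (by positivity)

lemma halfTrace_nonneg (X : LieCoord) (p : ℝ) : 0 ≤ halfTrace X p := Real.sqrt_nonneg _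

lemma det_curveLin {X : LieCoord} (hX : 0 ≤ negDet X) (p : ℝ) : (curveLin X p).det = 1 := by
  have h := halfTrace_sq hX p
  rw [negDet] at h
  rw [curveLin, Matrix.det_fin_two_of]
  linear_combination h

/-- The point of parameter `p` in `oneParam X`. -/
def curve (X : LieCoord) (hX : 0 ≤ negDet X) (p : ℝ) : GG :=
  (⟨curveLin X p, det_curveLin hX p⟩, curveTrans X p)

lemma oneParam_eq_range {X : LieCoord} (hX : 0 ≤ negDet X) :
    oneParam X = Set.range (curve X hX) := by
  ext x
  refine exists_congr fun p => ⟨fun h => Prod.ext (Subtype.ext h.1.symm) h.2.symm, ?_⟩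
  rintro rfl
  exact ⟨rfl, rfl⟩

lemma negDet_adjAct (y : GG) (X : LieCoord) : negDet (adjAct y X) = negDet X := by
  have h := SL2.det_eq y.1
  simp only [negDet, adjAct, Matrix.cons_val]
  linear_combination (X 0 ^ 2 + X 1 * X 2) *
    (y.1 0 0 * y.1 1 1 - y.1 0 1 * y.1 1 0 + 1) * h

lemma halfTrace_adjAct (y : GG) (X : LieCoord) (p : ℝ) :
    halfTrace (adjAct y X) p = halfTrace X p := by
  rw [halfTrace, negDet_adjAct, halfTrace]

lemma conj_curve (y : GG) {X : LieCoord} (hX : 0 ≤ negDet X) (p : ℝ) :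
    gmul (gmul y (curve X hX p)) (ginv y) =
      curve (adjAct y X) (negDet_adjAct y X ▸ hX) p := by
  have hdet := SL2.det_eq y.1
  have hsq := halfTrace_sq hX p
  have hpos := halfTrace_nonneg X p
  have hk : p ^ 2 / (1 + halfTrace X p) * negDet X = halfTrace X p - 1 := by
    field_simp
    linear_combination -hsq
  have hlin : ((gmul (gmul y (curve X hX p)) (ginv y)).1 : Matrix (Fin 2) (Fin 2) ℝ) =
      curveLin (adjAct y X) p := by
    change (y.1 : Matrix (Fin 2) (Fin 2) ℝ) * curveLin X p *
      (y.1 : Matrix (Fin 2) (Fin 2) ℝ).adjugate = _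
    rw [Matrix.adjugate_fin_two]
    simp only [curveLin, halfTrace_adjAct]
    ext i j
    fin_cases i <;> fin_cases j <;> simp [adjAct, Matrix.mul_apply, Fin.sum_univ_two]
    · linear_combination halfTrace X p * hdet
    · ring
    · ring
    · linear_combination halfTrace X p * hdet
  refine Prod.ext (Subtype.ext hlin) ?_
  have htrans : (gmul (gmul y (curve X hX p)) (ginv y)).2 =
      y.2 + (y.1 : Matrix (Fin 2) (Fin 2) ℝ).mulVec (curveTrans X p) -
        (curveLin (adjAct y X) p).mulVec y.2 := by
    rw [← hlin]
    simp only [gmul, ginv, curve, Matrix.mulVec_neg, Matrix.mulVec_mulVec, ← sub_eq_add_neg]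
    rfl
  rw [htrans]
  have h3 : adjAct y X 3 = y.1 0 0 * X 3 + y.1 0 1 * X 4 -
    (adjAct y X 0 * y.2 0 + adjAct y X 1 * y.2 1) := rfl
  have h4 : adjAct y X 4 = y.1 1 0 * X 3 + y.1 1 1 * X 4 -
    (adjAct y X 2 * y.2 0 - adjAct y X 0 * y.2 1) := rfl
  have h00 : adjAct y X 0 * y.1 0 0 + adjAct y X 1 * y.1 1 0 =
      y.1 0 0 * X 0 + y.1 0 1 * X 2 := by
    simp only [adjAct, Matrix.cons_val]
    linear_combination (y.1 0 0 * X 0 + y.1 0 1 * X 2) * hdet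
  have h01 : adjAct y X 0 * y.1 0 1 + adjAct y X 1 * y.1 1 1 =
      y.1 0 0 * X 1 - y.1 0 1 * X 0 := by
    simp only [adjAct, Matrix.cons_val]
    linear_combination (y.1 0 0 * X 1 - y.1 0 1 * X 0) * hdet
  have h10 : adjAct y X 2 * y.1 0 0 - adjAct y X 0 * y.1 1 0 =
      y.1 1 0 * X 0 + y.1 1 1 * X 2 := by
    simp only [adjAct, Matrix.cons_val]
    linear_combination (y.1 1 0 * X 0 + y.1 1 1 * X 2) * hdet
  have h11 : adjAct y X 2 * y.1 0 1 - adjAct y X 0 * y.1 1 1 =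
      y.1 1 0 * X 1 - y.1 1 1 * X 0 := by
    simp only [adjAct, Matrix.cons_val]
    linear_combination (y.1 1 0 * X 1 - y.1 1 1 * X 0) * hdet
  rw [← negDet_adjAct y, negDet] at hk
  simp only [curve, curveTrans, curveLin, halfTrace_adjAct]
  generalize adjAct y X = Y at *
  generalize p ^ 2 / (1 + halfTrace X p) = k at *
  ext i
  fin_cases i <;> simp [dotProduct, Fin.sum_univ_two, Matrix.vecHead, Matrix.vecTail]
  · linear_combination y.2 0 * hk - k * X 3 * h00 - k * X 4 * h01 - (p + k * Y 0) * h3 -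
      k * Y 1 * h4
  · linear_combination y.2 1 * hk - k * X 3 * h10 - k * X 4 * h11 - (p - k * Y 0) * h4 -
      k * Y 2 * h3

lemma conjSet_oneParam (y : GG) {X : LieCoord} (hX : 0 ≤ negDet X) :
    conjSet y (oneParam X) = oneParam (adjAct y X) := by
  rw [conjSet, oneParam_eq_range hX, oneParam_eq_range (negDet_adjAct y X ▸ hX), ← Set.range_comp]
  exact congrArg Set.range (funext fun p => conj_curve y hX p)

lemma negDet_smul (r : ℝ) (X : LieCoord) : negDet (r • X) = r ^ 2 * negDet X := by
  simp only [negDet, Pi.smul_apply, smul_eq_mul]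
  ring

lemma oneParam_smul {r : ℝ} (hr : r ≠ 0) (X : LieCoord) : oneParam (r • X) = oneParam X := by
  have hT (p : ℝ) : halfTrace (r • X) p = halfTrace X (p * r) := by
    simp only [halfTrace, negDet_smul]
    ring_nf
  have hL (p : ℝ) : curveLin (r • X) p = curveLin X (p * r) := by
    simp only [curveLin, hT, Pi.smul_apply, smul_eq_mul, mul_assoc]
  have hV (p : ℝ) : curveTrans (r • X) p = curveTrans X (p * r) := by
    simp only [curveTrans, hT, Pi.smul_apply, smul_eq_mul]
    ring_nf
  ext x
  simp only [oneParam, hL, hV, Set.mem_ofPred_eq]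
  exact (Equiv.mulRight₀ r hr).exists_congr_left.trans (by simp [hr])

/-- The generator of the diagonal subgroup. -/
def diagGen : LieCoord := ![1, 0, 0, 0, 0]

/-- The generator of `Vabc a b c`. -/
def vGen (a b c : ℝ) : LieCoord := ![0, a, 0, c, b]

lemma negDet_diagGen : negDet diagGen = 1 := by simp [negDet, diagGen]

lemma negDet_vGen (a b c : ℝ) : negDet (vGen a b c) = 0 := by simp [negDet, vGen]

lemma oneParam_vGen (a b c : ℝ) : oneParam (vGen a b c) = Vabc a b c := by
  have hT (p : ℝ) : halfTrace (vGen a b c) p = 1 := by simp [halfTrace, negDet_vGen]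
  ext x
  simp only [oneParam, Vabc, curveLin, curveTrans, hT, Set.mem_ofPred_eq]
  refine exists_congr fun p => ?_
  simp only [vGen, Matrix.cons_val]
  ring_nf

lemma oneParam_diagGen : oneParam diagGen = Aset := by
  have hT (p : ℝ) : halfTrace diagGen p = √(1 + p ^ 2) := by simp [halfTrace, negDet_diagGen]
  ext x
  simp only [oneParam, Aset, curveLin, curveTrans, hT, Set.mem_ofPred_eq]
  simp only [diagGen, Matrix.cons_val]
  constructor
  · rintro ⟨p, h1, h2⟩
    have hs : √(1 + p ^ 2) ^ 2 = 1 + p ^ 2 := Real.sq_sqrt (by positivity)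
    have hlt : |p| < √(1 + p ^ 2) := Real.lt_sqrt_of_sq_lt (by rw [sq_abs]; linarith)
    have hp : 0 < √(1 + p ^ 2) + p := by linarith [neg_abs_le p]
    refine ⟨√(1 + p ^ 2) + p, hp, ?_, ?_⟩
    · rw [h1, ← eq_inv_of_mul_eq_one_left (a := √(1 + p ^ 2) - p) (by linear_combination hs)]
      simp
    · rw [h2]
      simp
  · rintro ⟨a, ha, h1, h2⟩
    have hs : √(1 + ((a - a⁻¹) / 2) ^ 2) = (a + a⁻¹) / 2 := by
      rw [Real.sqrt_eq_iff_mul_self_eq_of_pos (by positivity)]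
      field_simp
      ring
    refine ⟨(a - a⁻¹) / 2, ?_, ?_⟩
    · rw [h1, hs]
      ring_nf
    · rw [h2]
      ext i
      fin_cases i <;> simp

lemma conjSet_Aset (y : GG) : conjSet y Aset = oneParam (adjAct y diagGen) := by
  rw [← oneParam_diagGen, conjSet_oneParam y (by simp [negDet_diagGen])]

lemma conjSet_Vabc (y : GG) (a b c : ℝ) :
    conjSet y (Vabc a b c) = oneParam (adjAct y (vGen a b c)) := by
  rw [← oneParam_vGen, conjSet_oneParam y (negDet_vGen a b c).ge]

/-- Generators of determinant `-1` are conjugate, up to sign, to `diagGen`. -/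
lemma exists_adjAct_diagGen_of_nonneg {X : LieCoord} (hX : negDet X = 1) (h0 : 0 ≤ X 0) :
    ∃ y : GG, X = adjAct y diagGen := by
  have h1 : 1 + X 0 ≠ 0 := by positivity
  rw [negDet] at hX
  refine ⟨(⟨!![X 0 + 1, -X 1 / (2 * (1 + X 0)); X 2, 1 / 2], ?_⟩,
    ![-(X 0 * X 3 + X 1 * X 4), -(X 2 * X 3 - X 0 * X 4)]), ?_⟩
  · rw [Matrix.det_fin_two_of]
    field_simp
    linear_combination hX
  · have e0 : (X 0 + 1) * 2⁻¹ + -X 1 / (2 * (1 + X 0)) * X 2 = X 0 := by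
      field_simp
      linear_combination -hX
    have e1 : 2 * (X 0 + 1) * (-X 1 / (2 * (1 + X 0))) = -X 1 := by
      field_simp
      ring
    ext i
    fin_cases i <;> simp [adjAct, diagGen, e0, e1]
    · ring
    · linear_combination -X 3 * hX
    · linear_combination -X 4 * hX

lemma exists_conjSet_Aset {X : LieCoord} (hX : 0 < negDet X) :
    ∃ y : GG, oneParam X = conjSet y Aset := by
  obtain ⟨r, hr, hr2, hr0⟩ : ∃ r : ℝ, r ≠ 0 ∧ r ^ 2 * negDet X = 1 ∧ 0 ≤ r * X 0 := by
    have hs : √(negDet X) ^ 2 = negDet X := Real.sq_sqrt hX.le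
    have hpos : 0 < √(negDet X) := Real.sqrt_pos.2 hX
    rcases le_total 0 (X 0) with h | h
    · exact ⟨(√(negDet X))⁻¹, by positivity, by rw [inv_pow, hs, inv_mul_cancel₀ hX.ne'],
        by positivity⟩
    · exact ⟨-(√(negDet X))⁻¹, neg_ne_zero.2 (inv_ne_zero hpos.ne'),
        by rw [neg_sq, inv_pow, hs, inv_mul_cancel₀ hX.ne'],
        mul_nonneg_of_nonpos_of_nonpos (by simp) h⟩
  obtain ⟨y, hy⟩ := exists_adjAct_diagGen_of_nonneg (X := r • X)
    (by rw [negDet_smul, hr2]) (by simpa using hr0)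
  exact ⟨y, by rw [conjSet_Aset, ← hy, oneParam_smul hr]⟩

lemma exists_conjSet_Vabc {X : LieCoord} (hX : negDet X = 0) (hne : X ≠ 0) :
    ∃ (y : GG) (r₁ r₂ r₃ : ℝ), (r₁ = 1 ∨ r₃ = 1 ∨ (r₁ = 0 ∧ r₂ = 1)) ∧
      oneParam X = conjSet y (Vabc r₁ r₂ r₃) := by
  rw [negDet] at hX
  suffices h : ∃ (y : GG) (r r₁ r₂ r₃ : ℝ), r ≠ 0 ∧ (r₁ = 1 ∨ r₃ = 1 ∨ (r₁ = 0 ∧ r₂ = 1)) ∧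
      X = r • adjAct y (vGen r₁ r₂ r₃) by
    obtain ⟨y, r, r₁, r₂, r₃, hr, hor, h⟩ := h
    exact ⟨y, r₁, r₂, r₃, hor, by rw [conjSet_Vabc, h, oneParam_smul hr]⟩
  by_cases h1 : X 1 = 0
  · have h0 : X 0 = 0 := by simpa [h1] using hX
    by_cases h2 : X 2 = 0
    · by_cases h3 : X 3 = 0
      · have h4 : X 4 ≠ 0 := fun h4 => hne <| by
          ext i
          fin_cases i <;> simp [h0, h1, h2, h3, h4]
        refine ⟨(⟨!![0, -1 / X 4; X 4, 0], by rw [Matrix.det_fin_two_of]; field_simp; simp⟩, 0), 1,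
          0, 0, 1, one_ne_zero, by simp, ?_⟩
        ext i
        fin_cases i <;> simp [adjAct, vGen, h0, h1, h2, h3]
      · refine ⟨(⟨!![X 3, 0; X 4, 1 / X 3], by rw [Matrix.det_fin_two_of]; field_simp; simp⟩, 0), 1,
          0, 0, 1, one_ne_zero, by simp, ?_⟩
        ext i
        fin_cases i <;> simp [adjAct, vGen, h0, h1, h2]
    · refine ⟨(⟨!![0, -1; 1, 0], by simp [Matrix.det_fin_two_of]⟩, 0), -X 2,
        1, X 3 / X 2, -X 4 / X 2, neg_ne_zero.2 h2, by simp, ?_⟩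
      ext i
      fin_cases i <;> simp [adjAct, vGen, h0, h1] <;> field_simp
  · refine ⟨(⟨!![1, 0; -X 0 / X 1, 1], by simp [Matrix.det_fin_two_of]⟩, 0), X 1,
      1, (X 4 + X 0 / X 1 * X 3) / X 1, X 3 / X 1, h1, by simp, ?_⟩
    ext i
    fin_cases i <;> simp [adjAct, vGen] <;> field_simp
    · linear_combination hX
    · ring

/-- The generator of the one-parameter subgroup through `x`, up to scaling. -/
def logCoord (x : GG) : LieCoord :=
  ![(x.1 0 0 - x.1 1 1) / 2, x.1 0 1, x.1 1 0,
    ((1 + x.1 0 0 + x.1 1 1) * x.2 0 - (x.1 0 0 * x.2 0 + x.1 0 1 * x.2 1)) / 2,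
    ((1 + x.1 0 0 + x.1 1 1) * x.2 1 - (x.1 1 0 * x.2 0 + x.1 1 1 * x.2 1)) / 2]

lemma logCoord_curve {X : LieCoord} (hX : 0 ≤ negDet X) (p : ℝ) :
    logCoord (curve X hX p) = p • X := by
  have hsq := halfTrace_sq hX p
  have hpos := halfTrace_nonneg X p
  rw [negDet] at hsq
  ext i
  fin_cases i <;> simp [logCoord, curve, curveLin, curveTrans] <;> field_simp
  · linear_combination p * X 3 * hsq
  · linear_combination p * X 4 * hsq

lemma isInducing_coe : IsInducing fun g : SL2 => (g : Matrix (Fin 2) (Fin 2) ℝ) := ⟨rfl⟩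

lemma continuous_coe_fst : Continuous fun x : GG => (x.1 : Matrix (Fin 2) (Fin 2) ℝ) :=
  isInducing_coe.continuous.comp continuous_fst

lemma continuous_entry (i j : Fin 2) : Continuous fun x : GG => x.1 i j :=
  continuous_coe_fst.matrix_elem i j

lemma continuous_logCoord : Continuous logCoord := by
  have h := continuous_entry
  refine continuous_pi fun i => ?_
  fin_cases i <;> simp only [logCoord] <;> simp <;> fun_prop

lemma continuous_negDet : Continuous negDet := by
  unfold negDet
  fun_prop

lemma continuous_halfTrace : Continuous fun z : LieCoord × ℝ => halfTrace z.1 z.2 := by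
  have := continuous_negDet
  unfold halfTrace
  fun_prop

lemma continuous_curveLin : Continuous fun z : LieCoord × ℝ => curveLin z.1 z.2 := by
  have := continuous_halfTrace
  refine continuous_matrix fun i j => ?_
  fin_cases i <;> fin_cases j <;> simp [curveLin] <;> fun_prop

lemma continuous_curveTrans : Continuous fun z : LieCoord × ℝ => curveTrans z.1 z.2 := by
  have := continuous_halfTrace
  have hne (z : LieCoord × ℝ) : 1 + halfTrace z.1 z.2 ≠ 0 := by
    have := halfTrace_nonneg z.1 z.2
    positivity
  refine continuous_pi fun i => ?_
  fin_cases i <;> simp [curveTrans] <;> fun_prop (disch := exact hne _)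

lemma continuous_adjAct (y : GG) : Continuous (adjAct y) := by
  refine continuous_pi fun i => ?_
  fin_cases i <;> simp [adjAct] <;> fun_prop

lemma Filter.Tendsto.curveLin {Z : ℕ → LieCoord} {X : LieCoord} (hZ : Tendsto Z atTop (𝓝 X))
    {p : ℕ → ℝ} {q : ℝ} (hp : Tendsto p atTop (𝓝 q)) :
    Tendsto (fun n => curveLin (Z n) (p n)) atTop (𝓝 (curveLin X q)) := by
  have h := Tendsto.comp (continuous_curveLin.tendsto (X, q)) (hZ.prodMk_nhds hp)
  exact h

lemma Filter.Tendsto.curveTrans {Z : ℕ → LieCoord} {X : LieCoord} (hZ : Tendsto Z atTop (𝓝 X))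
    {p : ℕ → ℝ} {q : ℝ} (hp : Tendsto p atTop (𝓝 q)) :
    Tendsto (fun n => curveTrans (Z n) (p n)) atTop (𝓝 (curveTrans X q)) := by
  have h := Tendsto.comp (continuous_curveTrans.tendsto (X, q)) (hZ.prodMk_nhds hp)
  exact h

/-- One-parameter subgroups depend continuously on their nonzero generators. -/
lemma chabautyTendsto_oneParam {Z : ℕ → LieCoord} {X : LieCoord} (hZ : Tendsto Z atTop (𝓝 X))
    (hdet : ∀ n, 0 ≤ negDet (Z n)) (hX : X ≠ 0) :
    ChabautyTendsto (fun n => oneParam (Z n)) (oneParam X) := by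
  constructor
  · rintro x ⟨p, h1, h2⟩
    refine ⟨fun n => curve (Z n) (hdet n) p, fun n => ⟨p, rfl, rfl⟩, ?_⟩
    have hlin : Tendsto (fun n => curveLin (Z n) p) atTop
        (𝓝 (x.1 : Matrix (Fin 2) (Fin 2) ℝ)) := by
      rw [h1]
      exact hZ.curveLin tendsto_const_nhds
    have htrans : Tendsto (fun n => curveTrans (Z n) p) atTop (𝓝 x.2) := by
      rw [h2]
      exact hZ.curveTrans tendsto_const_nhds
    have hlin' : Tendsto (fun n => (curve (Z n) (hdet n) p).1) atTop (𝓝 x.1) :=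
      isInducing_coe.tendsto_nhds_iff.2 hlin
    exact hlin'.prodMk_nhds htrans
  · intro k hk u hu x hux
    obtain ⟨i, hi⟩ := Function.ne_iff.1 hX
    have hZk : Tendsto (fun n => Z (k n)) atTop (𝓝 X) := hZ.comp hk.tendsto_atTop
    have hu' (n : ℕ) : ∃ p, curve (Z (k n)) (hdet _) p = u n := by
      rw [← Set.mem_range, ← oneParam_eq_range]
      exact hu n
    choose p hp using hu'
    have hlim : Tendsto p atTop (𝓝 (logCoord x i / X i)) := by
      have hZi : Tendsto (fun n => Z (k n) i) atTop (𝓝 (X i)) :=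
        ((continuous_apply i).tendsto X).comp hZk
      have hlog : Tendsto (fun n => logCoord (u n) i) atTop (𝓝 (logCoord x i)) :=
        (((continuous_apply i).comp continuous_logCoord).tendsto x).comp hux
      refine (hlog.div hZi hi).congr' ?_
      filter_upwards [hZi.eventually_ne hi] with n hn
      simp only [Pi.div_apply, ← hp, logCoord_curve, Pi.smul_apply, smul_eq_mul]
      exact mul_div_cancel_right₀ _ hn
    have h1 : Tendsto (fun n => curveLin (Z (k n)) (p n)) atTop
        (𝓝 (x.1 : Matrix (Fin 2) (Fin 2) ℝ)) := by
      refine ((continuous_coe_fst.tendsto x).comp hux).congr fun n => ?_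
      rw [Function.comp_apply, ← hp n]
      rfl
    have h2 : Tendsto (fun n => curveTrans (Z (k n)) (p n)) atTop (𝓝 x.2) := by
      refine ((continuous_snd.tendsto x).comp hux).congr fun n => ?_
      rw [Function.comp_apply, ← hp n]
      rfl
    exact ⟨logCoord x i / X i,
      tendsto_nhds_unique h1 (hZk.curveLin hlim),
      tendsto_nhds_unique h2 (hZk.curveTrans hlim)⟩

lemma ChabautyTendsto.comp_strictMono {X : Type*} [TopologicalSpace X] {S : ℕ → Set X} {T : Set X}
    (h : ChabautyTendsto S T) {φ : ℕ → ℕ} (hφ : StrictMono φ) :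
    ChabautyTendsto (fun n => S (φ n)) T := by
  refine ⟨fun x hx => ?_, fun k hk u hu x hux => h.2 (φ ∘ k) (hφ.comp hk) u hu x hux⟩
  obtain ⟨u, hu, hux⟩ := h.1 x hx
  exact ⟨u ∘ φ, fun n => hu _, hux.comp hφ.tendsto_atTop⟩

lemma ChabautyTendsto.subset {X : Type*} [TopologicalSpace X] {S : ℕ → Set X} {T T' : Set X}
    (h : ChabautyTendsto S T) (h' : ChabautyTendsto S T') : T ⊆ T' := fun x hx => by
  obtain ⟨u, hu, hux⟩ := h.1 x hx
  exact h'.2 id strictMono_id u hu x hux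

lemma ChabautyTendsto.unique {X : Type*} [TopologicalSpace X] {S : ℕ → Set X} {T T' : Set X}
    (h : ChabautyTendsto S T) (h' : ChabautyTendsto S T') : T = T' :=
  (h.subset h').antisymm (h'.subset h)

lemma chabautyTendsto_const {X : Type*} [TopologicalSpace X] {T : Set X} (hT : IsClosed T) :
    ChabautyTendsto (fun _ => T) T :=
  ⟨fun x hx => ⟨fun _ => x, fun _ => hx, tendsto_const_nhds⟩,
    fun _ _ _ hu _ hux => hT.mem_of_tendsto hux (Eventually.of_forall hu)⟩

/-- A Chabauty limit of conjugates of the diagonal group is a one-parameter subgroup. -/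
lemma exists_eq_oneParam_of_chabautyTendsto {x : ℕ → GG} {H : Set GG}
    (h : ChabautyTendsto (fun n => conjSet (x n) Aset) H) :
    ∃ X : LieCoord, X ≠ 0 ∧ 0 ≤ negDet X ∧ H = oneParam X := by
  have hne (n : ℕ) : adjAct (x n) diagGen ≠ 0 := fun h0 => by
    have := negDet_adjAct (x n) diagGen
    rw [h0, negDet_diagGen] at this
    simp [negDet] at this
  let Z (n : ℕ) : LieCoord := ‖adjAct (x n) diagGen‖⁻¹ • adjAct (x n) diagGen
  have hZ (n : ℕ) : Z n ∈ Metric.sphere (0 : LieCoord) 1 := by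
    simpa using norm_smul_inv_norm (𝕜 := ℝ) (hne n)
  have hdet (n : ℕ) : 0 ≤ negDet (Z n) := by
    rw [negDet_smul, negDet_adjAct, negDet_diagGen]
    positivity
  obtain ⟨X, hX, φ, hφ, hlim⟩ := (isCompact_sphere (0 : LieCoord) 1).tendsto_subseq hZ
  have hX0 : X ≠ 0 := ne_zero_of_mem_unit_sphere ⟨X, hX⟩
  refine ⟨X, hX0, ge_of_tendsto' ((continuous_negDet.tendsto X).comp hlim) fun n => hdet _,
    (h.comp_strictMono hφ).unique ?_⟩
  have hconj (n : ℕ) : conjSet (x n) Aset = oneParam (Z n) := by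
    rw [conjSet_Aset, oneParam_smul (inv_ne_zero (norm_ne_zero_iff.2 (hne n)))]
  simp only [hconj]
  exact chabautyTendsto_oneParam hlim (fun n => hdet _) hX0

/-- The one-parameter subgroups of `vGen a b c` are limits of conjugates of the diagonal group. -/
lemma exists_chabautyTendsto_conjSet_Vabc (y : GG) {a b c : ℝ} (h : vGen a b c ≠ 0) :
    ∃ x : ℕ → GG, ChabautyTendsto (fun n => conjSet (x n) Aset) (conjSet y (Vabc a b c)) := by
  let Z (n : ℕ) : LieCoord := adjAct y (![1 / ((n : ℝ) + 1), a, 0, c, b])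
  have hpos (n : ℕ) : 0 < negDet (Z n) := by
    rw [negDet_adjAct]
    simp only [negDet, Matrix.cons_val, mul_zero, add_zero]
    positivity
  have hlim : Tendsto Z atTop (𝓝 (adjAct y (vGen a b c))) := by
    refine ((continuous_adjAct y).tendsto _).comp (tendsto_pi_nhds.2 fun i => ?_)
    fin_cases i <;> simp [vGen]
    simpa using tendsto_one_div_add_atTop_nhds_zero_nat (𝕜 := ℝ)
  have hne : adjAct y (vGen a b c) ≠ 0 := fun h0 => h <| by
    have hdet := SL2.det_eq y.1
    have e0 := congrFun h0 0
    have e1 := congrFun h0 1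
    have e2 := congrFun h0 2
    have e3 := congrFun h0 3
    have e4 := congrFun h0 4
    simp only [adjAct, vGen, Matrix.cons_val, Pi.zero_apply] at e0 e1 e2 e3 e4
    have ha : a = 0 := by
      linear_combination y.1 1 1 ^ 2 * e1 + 2 * y.1 0 1 * y.1 1 1 * e0 - y.1 0 1 ^ 2 * e2 -
        a * (y.1 0 0 * y.1 1 1 - y.1 0 1 * y.1 1 0 + 1) * hdet
    simp only [ha, mul_zero, zero_mul, add_zero, sub_zero] at e3 e4
    have hc : c = 0 := by linear_combination y.1 1 1 * e3 - y.1 0 1 * e4 - c * hdet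
    have hb : b = 0 := by linear_combination y.1 0 0 * e4 - y.1 1 0 * e3 - b * hdet
    simp [vGen, ha, hb, hc]
  choose x hx using fun n => exists_conjSet_Aset (hpos n)
  refine ⟨x, ?_⟩
  simp only [← hx, conjSet_Vabc]
  exact chabautyTendsto_oneParam hlim (fun n => (hpos n).le) hne

/-- A closed subgroup `H` of `G` is a Chabauty limit of conjugates of the diagonal group `A` iff
`H` is a conjugate of `A` or a conjugate of some `V_{(r₁,r₂,r₃)}` with `r₁ = 1`, or `r₃ = 1`,
or (`r₁ = 0` and `r₂ = 1`). -/
theorem stmt_7 (H : Set GG) (hH : IsClosedSubgroup H) :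
    (∃ x : ℕ → GG, ChabautyTendsto (fun n => conjSet (x n) Aset) H) ↔
      (∃ y : GG, H = conjSet y Aset ∨
        ∃ r₁ r₂ r₃ : ℝ, (r₁ = 1 ∨ r₃ = 1 ∨ (r₁ = 0 ∧ r₂ = 1)) ∧
          H = conjSet y (Vabc r₁ r₂ r₃)) := by
  constructor
  · rintro ⟨x, hx⟩
    obtain ⟨X, hX0, hX, rfl⟩ := exists_eq_oneParam_of_chabautyTendsto hx
    rcases hX.eq_or_lt with h | h
    · obtain ⟨y, r⟩ := exists_conjSet_Vabc h.symm hX0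
      exact ⟨y, Or.inr r⟩
    · obtain ⟨y, hy⟩ := exists_conjSet_Aset h
      exact ⟨y, Or.inl hy⟩
  · rintro ⟨y, rfl | ⟨r₁, r₂, r₃, hr, rfl⟩⟩
    · exact ⟨fun _ => y, chabautyTendsto_const hH.1⟩
    · refine exists_chabautyTendsto_conjSet_Vabc y fun h => ?_
      have h1 : r₁ = 0 := congrFun h 1
      have h2 : r₂ = 0 := congrFun h 4
      have h3 : r₃ = 0 := congrFun h 3
      simp [h1, h2, h3] at hr

end
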